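/- arXiv:math/0001149 — 3 statements merged into one kernel-verified Lean document; each statement's English description precedes it below -/
import Mathlib

section
/- Let U ⊆ ℝⁿ and V ⊆ ℝᵐ be open neighborhoods of 0, p : U × V × V → V smooth with p(u,0,w) = w and p(u,v,0) = v, and B(u,·,·) = ∂²p/∂v∂w(u,0,0). Suppose V₀ ⊆ V is an open neighborhood of 0 and f : U × V₀ → V is a smooth map satisfying p(u,v,f(u,v)) = 0 for all (u,v) ∈ U × V₀. Then f(u,0) = 0 for all u, and for each u ∈ U there exist δ > 0 and C > 0 such that ‖f(u,v) + v − B(u,v,v)‖ ≤ C‖v‖³ for all v with ‖v‖ < δ; that is, f(u,v) = −v + B(u,v,v) + O(‖v‖³). -/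
open Set

open Asymptotics Filter Topology in
/-- A function of two variables that is the identity on each axis equals the sum of its arguments
plus the mixed second derivative, up to a third-order error. -/
theorem norm_sub_add_mixed_fderiv_le {E : Type*} [NormedAddCommGroup E] [NormedSpace ℝ E]
    {P : E × E → E} (hP : ContDiffAt ℝ 3 P 0)
    (hP0w : ∀ᶠ w in 𝓝 0, P (0, w) = w) (hPv0 : ∀ᶠ v in 𝓝 0, P (v, 0) = v) :
    ∃ K : ℝ, ∀ᶠ q in 𝓝 (0 : E × E),
      ‖P q - q.1 - q.2 - fderiv ℝ (fun v => fderiv ℝ (fun w => P (v, w)) 0) 0 q.1 q.2‖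
        ≤ K * ‖q‖ * ‖q.1‖ * ‖q.2‖ := by
  set B := fderiv ℝ (fun v => fderiv ℝ (fun w => P (v, w)) 0) 0 with hB
  let D : E × E → E →L[ℝ] E := fun q => (fderiv ℝ P q).comp (ContinuousLinearMap.inr ℝ E E)
  let D' : E × E → E →L[ℝ] E →L[ℝ] E :=
    fun q => (fderiv ℝ D q).comp (ContinuousLinearMap.inl ℝ E E)
  have hD : ContDiffAt ℝ 2 D 0 :=
    (hP.fderiv_right (m := 2) (by norm_num)).clm_comp contDiffAt_const
  have hD' : ContDiffAt ℝ 1 D' 0 :=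
    (hD.fderiv_right (m := 1) (by norm_num)).clm_comp contDiffAt_const
  have hPd : ∀ᶠ q in 𝓝 (0 : E × E), DifferentiableAt ℝ P q :=
    (hP.eventually (by norm_num)).mono fun q hq => hq.differentiableAt (by norm_num)
  have hDd : ∀ᶠ q in 𝓝 (0 : E × E), DifferentiableAt ℝ D q :=
    (hD.eventually (by norm_num)).mono fun q hq => hq.differentiableAt (by norm_num)
  have hasD : ∀ v w, DifferentiableAt ℝ P (v, w) →
      HasFDerivAt (fun w => P (v, w)) (D (v, w)) w := fun v w h =>
    HasFDerivAt.comp w h.hasFDerivAt (hasFDerivAt_prodMk_right v w)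
  have hasD' : ∀ v w, DifferentiableAt ℝ D (v, w) →
      HasFDerivAt (fun v => D (v, w)) (D' (v, w)) v := fun v w h =>
    HasFDerivAt.comp (g := D) (f := fun v => (v, w)) v h.hasFDerivAt (hasFDerivAt_prodMk_left v w)
  have tl : Tendsto (fun v : E => (v, (0 : E))) (𝓝 0) (𝓝 0) :=
    (Continuous.prodMk_left (0 : E)).tendsto' 0 0 rfl
  have tr : Tendsto (fun w : E => ((0 : E), w)) (𝓝 0) (𝓝 0) :=
    (Continuous.prodMk_right (0 : E)).tendsto' 0 0 rfl
  have hB0 : B = D' 0 := by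
    have h1 : (fun v => fderiv ℝ (fun w => P (v, w)) 0) =ᶠ[𝓝 0] fun v => D (v, 0) :=
      (tl.eventually hPd).mono fun v hv => (hasD v 0 hv).fderiv
    rw [hB, h1.fderiv_eq]
    exact (hasD' 0 0 hDd.self_of_nhds).fderiv
  have hD0 : ∀ᶠ w in 𝓝 0, D (0, w) = ContinuousLinearMap.id ℝ E := by
    filter_upwards [tr.eventually hPd, hP0w.eventually_nhds] with w hw hw'
    rw [← (hasD 0 w hw).fderiv]
    exact (EventuallyEq.fderiv_eq hw').trans fderiv_fun_id
  obtain ⟨K, t, ht, hK⟩ := hD'.exists_lipschitzOnWith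
  have hKb : ∀ᶠ q in 𝓝 (0 : E × E), ‖D' q - B‖ ≤ K * ‖q‖ := by
    filter_upwards [ht] with q hq
    simpa [hB0] using hK.norm_sub_le hq (mem_of_mem_nhds ht)
  refine ⟨K, ?_⟩
  obtain ⟨r, hr, hball⟩ := Metric.eventually_nhds_iff_ball.1 (hPd.and (hDd.and hKb))
  obtain ⟨s, hs, hsball⟩ := Metric.eventually_nhds_iff_ball.1 (hD0.and hPv0)
  filter_upwards [Metric.ball_mem_nhds (0 : E × E) (lt_min hr hs)] with ⟨v, w⟩ hq
  have hqn : ‖(v, w)‖ < min r s := by simpa using hq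
  have hsmall : ∀ x y : E, ‖x‖ ≤ ‖v‖ → ‖y‖ ≤ ‖w‖ → ‖(x, y)‖ ≤ ‖(v, w)‖ := fun x y hx hy => by
    simpa only [Prod.norm_mk] using max_le_max hx hy
  have hin : ∀ x y : E, ‖x‖ ≤ ‖v‖ → ‖y‖ ≤ ‖w‖ → (x, y) ∈ Metric.ball (0 : E × E) r :=
    fun x y hx hy => by
      rw [mem_ball_zero_iff]
      exact (hsmall x y hx hy).trans_lt (hqn.trans_le (min_le_left _ _))
  have hvs : ‖v‖ < s := (norm_fst_le (v, w)).trans_lt (hqn.trans_le (min_le_right _ _))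
  have hws : ‖w‖ < s := (norm_snd_le (v, w)).trans_lt (hqn.trans_le (min_le_right _ _))
  have step : ∀ y : E, ‖y‖ ≤ ‖w‖ →
      ‖D (v, y) - ContinuousLinearMap.id ℝ E - B v‖ ≤ K * ‖(v, w)‖ * ‖v‖ := by
    intro y hy
    have := (convex_closedBall (0 : E) ‖v‖).norm_image_sub_le_of_norm_hasFDerivWithin_le
      (f := fun x => D (x, y) - B x) (f' := fun x => D' (x, y) - B) (C := K * ‖(v, w)‖)
      (x := 0) (y := v)
      (fun x hx => ((hasD' x y (hball _ (hin x y (by simpa using hx) hy)).2.1).sub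
        B.hasFDerivAt).hasFDerivWithinAt)
      (fun x hx => (hball _ (hin x y (by simpa using hx) hy)).2.2.trans
        (mul_le_mul_of_nonneg_left (hsmall x y (by simpa using hx) hy) K.2))
      (by simp) (by simp)
    rw [(hsball y (by simpa using hy.trans_lt hws)).1] at this
    simpa [sub_right_comm] using this
  have := (convex_closedBall (0 : E) ‖w‖).norm_image_sub_le_of_norm_hasFDerivWithin_le
    (f := fun y => P (v, y) - y - B v y)
    (f' := fun y => D (v, y) - ContinuousLinearMap.id ℝ E - B v)
    (C := K * ‖(v, w)‖ * ‖v‖) (x := 0) (y := w)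
    (fun y hy => (((hasD v y (hball _ (hin v y le_rfl (by simpa using hy))).1).sub
      (hasFDerivAt_id y)).sub (B v).hasFDerivAt).hasFDerivWithinAt)
    (fun y hy => step y (by simpa using hy)) (by simp) (by simp)
  rw [(hsball v (by simpa using hvs)).2] at this
  simp only [map_zero, sub_zero] at this
  convert this using 2
  abel

open Asymptotics Filter Topology in
/-- The second-order expansion of a right inverse for a product that is the identity on each
axis. -/
theorem isBigO_inverse_add_sub_mixed_fderiv {E : Type*} [NormedAddCommGroup E] [NormedSpace ℝ E]
    {P : E × E → E} {g : E → E} (hP : ContDiffAt ℝ 3 P 0)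
    (hP0w : ∀ᶠ w in 𝓝 0, P (0, w) = w) (hPv0 : ∀ᶠ v in 𝓝 0, P (v, 0) = v)
    (hg : DifferentiableAt ℝ g 0) (hg0 : g 0 = 0) (hPg : ∀ᶠ v in 𝓝 0, P (v, g v) = 0) :
    (fun v => g v + v - fderiv ℝ (fun v => fderiv ℝ (fun w => P (v, w)) 0) 0 v v)
      =O[𝓝 0] fun v => ‖v‖ ^ 3 := by
  obtain ⟨K, hK⟩ := norm_sub_add_mixed_fderiv_le hP hP0w hPv0
  set B := fderiv ℝ (fun v => fderiv ℝ (fun w => P (v, w)) 0) 0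
  have hid : (fun v : E => v) =O[𝓝 0] fun v => ‖v‖ := (isBigO_refl _ _).norm_right
  have hgO : g =O[𝓝 0] fun v => ‖v‖ := by
    simpa [hg0] using hg.isBigO_sub.norm_right
  have hgt : Tendsto (fun v => (v, g v)) (𝓝 0) (𝓝 (0 : E × E)) :=
    tendsto_id.prodMk_nhds (by simpa [hg0] using hg.continuousAt.tendsto)
  have hBO : ∀ {h : E → E} {k : ℕ}, (h =O[𝓝 0] fun v => ‖v‖ ^ k) →
      (fun v => B v (h v)) =O[𝓝 0] fun v => ‖v‖ ^ (k + 1) := fun {h k} hh => by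
    refine (IsBigO.of_bound ‖B‖ (Eventually.of_forall fun v => ?_) :
      _ =O[𝓝 0] fun v => ‖v‖ * ‖h v‖).trans ?_
    · simpa [mul_assoc] using B.le_opNorm₂ v (h v)
    · simpa [pow_succ'] using (isBigO_refl (fun v : E => ‖v‖) _).mul hh.norm_left
  have hR : (fun v => P (v, g v) - v - g v - B v (g v)) =O[𝓝 0] fun v => ‖v‖ ^ 3 := by
    refine (IsBigO.of_bound K ((hgt.eventually hK).mono fun v hv => ?_) :
      _ =O[𝓝 0] fun v => ‖(v, g v)‖ * ‖v‖ * ‖g v‖).trans ?_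
    · simpa only [norm_mul, norm_norm, mul_assoc] using hv
    · simpa [pow_succ] using
        ((hid.prod_left hgO).norm_left.mul (isBigO_refl (fun v : E => ‖v‖) _)).mul hgO.norm_left
  have h32 : (fun v : E => ‖v‖ ^ 3) =O[𝓝 0] fun v => ‖v‖ ^ 2 :=
    (isLittleO_norm_pow_norm_pow (by norm_num)).isBigO
  have h2 : (fun v => g v + v) =O[𝓝 0] fun v => ‖v‖ ^ 2 := by
    refine ((hBO (k := 1) (by simpa using hgO)).add (hR.trans h32)).neg_left.congr' ?_ .rfl
    filter_upwards [hPg] with v hv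
    rw [hv]; abel
  refine ((hBO h2).add hR).neg_left.congr' ?_ .rfl
  filter_upwards [hPg] with v hv
  rw [hv, map_add]; abel

/-- If `p : U × V × V → V` is smooth with `p (u,0,w) = w`, `p (u,v,0) = v`,
`B u := ∂²p/∂v∂w (u,0,0)`, and `f : U × V₀ → V` is smooth with `p (u, v, f (u,v)) = 0`, then
`f (u,0) = 0` and `f (u,v) = -v + B u v v + O (‖v‖³)`. -/
theorem stmt_11 (n m : ℕ) (U : Set (EuclideanSpace ℝ (Fin n))) (V : Set (EuclideanSpace ℝ (Fin m)))
    (hU : IsOpen U) (hV : IsOpen V) (hU0 : (0 : EuclideanSpace ℝ (Fin n)) ∈ U)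
    (hV0 : (0 : EuclideanSpace ℝ (Fin m)) ∈ V)
    (p : EuclideanSpace ℝ (Fin n) → EuclideanSpace ℝ (Fin m) → EuclideanSpace ℝ (Fin m) →
      EuclideanSpace ℝ (Fin m))
    (hp : ContDiffOn ℝ (⊤ : ℕ∞) (fun q : EuclideanSpace ℝ (Fin n) × EuclideanSpace ℝ (Fin m) ×
      EuclideanSpace ℝ (Fin m) => p q.1 q.2.1 q.2.2) (U ×ˢ V ×ˢ V))
    (hp0w : ∀ u ∈ U, ∀ w ∈ V, p u 0 w = w)
    (hpv0 : ∀ u ∈ U, ∀ v ∈ V, p u v 0 = v)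
    (V₀ : Set (EuclideanSpace ℝ (Fin m))) (hV₀ : IsOpen V₀) (hV₀0 : (0 : EuclideanSpace ℝ (Fin m)) ∈ V₀)
    (hV₀V : V₀ ⊆ V)
    (f : EuclideanSpace ℝ (Fin n) → EuclideanSpace ℝ (Fin m) → EuclideanSpace ℝ (Fin m))
    (hf : ContDiffOn ℝ (⊤ : ℕ∞) (fun q : EuclideanSpace ℝ (Fin n) × EuclideanSpace ℝ (Fin m) =>
      f q.1 q.2) (U ×ˢ V₀))
    (hfV : ∀ u ∈ U, ∀ v ∈ V₀, f u v ∈ V)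
    (hpf : ∀ u ∈ U, ∀ v ∈ V₀, p u v (f u v) = 0) :
    (∀ u ∈ U, f u 0 = 0) ∧
    ∀ u ∈ U, ∃ δ > (0:ℝ), ∃ C > (0:ℝ), ∀ v : EuclideanSpace ℝ (Fin m), ‖v‖ < δ →
      ‖f u v + v - fderiv ℝ (fun v' => fderiv ℝ (fun w' => p u v' w') 0) 0 v v‖ ≤ C * ‖v‖ ^ 3 := by
  have hg0 : ∀ u ∈ U, f u 0 = 0 := fun u hu => by
    rw [← hp0w u hu _ (hfV u hu 0 hV₀0), hpf u hu 0 hV₀0]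
  refine ⟨hg0, fun u hu => ?_⟩
  have hP : ContDiffAt ℝ 3 (fun q : EuclideanSpace ℝ (Fin m) × EuclideanSpace ℝ (Fin m) =>
      p u q.1 q.2) 0 :=
    ((hp.contDiffAt ((hU.prod (hV.prod hV)).mem_nhds ⟨hu, hV0, hV0⟩)).of_le
      (WithTop.coe_le_coe.2 (le_top : (3 : ℕ∞) ≤ ⊤))).comp (0 : EuclideanSpace ℝ (Fin m) × EuclideanSpace ℝ (Fin m))
      (contDiffAt_const.prodMk contDiffAt_id)
  have hg : DifferentiableAt ℝ (f u) 0 :=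
    ((hf.contDiffAt ((hU.prod hV₀).mem_nhds ⟨hu, hV₀0⟩)).differentiableAt (by simp)).comp
      (0 : EuclideanSpace ℝ (Fin m)) ((differentiableAt_const u).prodMk differentiableAt_id)
  obtain ⟨C, hC, hCb⟩ := (isBigO_inverse_add_sub_mixed_fderiv hP
    (Filter.eventually_of_mem (hV.mem_nhds hV0) (hp0w u hu))
    (Filter.eventually_of_mem (hV.mem_nhds hV0) (hpv0 u hu)) hg (hg0 u hu)
    (Filter.eventually_of_mem (hV₀.mem_nhds hV₀0) (hpf u hu))).exists_pos
  obtain ⟨δ, hδ, h⟩ := Metric.eventually_nhds_iff.1 hCb.bound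
  exact ⟨δ, hδ, C, hC, fun v hv => by simpa using h (by simpa using hv)⟩
end

section
/- Let U ⊆ ℝⁿ be open and let B : U → (ℝᵐ × ℝᵐ → ℝᵐ) be a smooth family of bilinear maps. For a ∈ ℝᵐ define the smooth vector field X_a on U × ℝᵐ by X_a(u,v) = (0, a + B(u)(v,a)). Then for all a, b ∈ ℝᵐ and (u,v) ∈ U × ℝᵐ, the Lie bracket satisfies [X_a, X_b](u,v) = (0, B(u)(a,b) − B(u)(b,a) + B(u)(B(u)(v,a), b) − B(u)(B(u)(v,b), a)); in particular [X_a, X_b](u,0) = (0, B(u)(a,b) − B(u)(b,a)). -/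
open Set

/-- The derivative of `(u, v) ↦ (0, a + B u v a)` in a vertical direction `(0, w)` is
`(0, B u w a)`. -/
theorem fderiv_vertical_apply {E F : Type*} [NormedAddCommGroup E] [NormedSpace ℝ E]
    [NormedAddCommGroup F] [NormedSpace ℝ F] {B : E → F →L[ℝ] F →L[ℝ] F} {u : E}
    (hB : DifferentiableAt ℝ B u) (a v w : F) :
    fderiv ℝ (fun p : E × F => ((0 : E), a + B p.1 p.2 a)) (u, v) (0, w) = (0, B u w a) := by
  have h₀ : HasFDerivAt (fun p : E × F => p.1) (ContinuousLinearMap.fst ℝ E F) (u, v) :=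
    hasFDerivAt_fst
  have h₁ : HasFDerivAt (fun p : E × F => B p.1)
      ((fderiv ℝ B u).comp (ContinuousLinearMap.fst ℝ E F)) (u, v) :=
    HasFDerivAt.comp (g := B) (u, v) hB.hasFDerivAt h₀
  have h₂ := ((h₁.clm_apply hasFDerivAt_snd).clm_apply (hasFDerivAt_const a (u, v))).const_add a
  rw [((hasFDerivAt_const (0 : E) (u, v)).prodMk h₂).fderiv]
  simp

/-- For a smooth family `B : U → Bil(ℝᵐ, ℝᵐ; ℝᵐ)` of bilinear maps and
`a : ℝᵐ`, let `X_a (u,v) = (0, a + B u v a)` be a vector field on `U × ℝᵐ`. Then the Lie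
bracket `[X_a, X_b] (x) = D X_b (x) (X_a x) - D X_a (x) (X_b x)` satisfies
`[X_a, X_b] (u,v) = (0, B u a b - B u b a + B u (B u v a) b - B u (B u v b) a)`;
in particular `[X_a, X_b] (u,0) = (0, B u a b - B u b a)`. -/
theorem stmt_12 (n m : ℕ) (U : Set (EuclideanSpace ℝ (Fin n))) (hU : IsOpen U)
    (B : EuclideanSpace ℝ (Fin n) →
      EuclideanSpace ℝ (Fin m) →L[ℝ] EuclideanSpace ℝ (Fin m) →L[ℝ] EuclideanSpace ℝ (Fin m))
    (hB : ContDiffOn ℝ (⊤ : ℕ∞) B U)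
    (X : EuclideanSpace ℝ (Fin m) → EuclideanSpace ℝ (Fin n) × EuclideanSpace ℝ (Fin m) →
      EuclideanSpace ℝ (Fin n) × EuclideanSpace ℝ (Fin m))
    (hX : ∀ a uv, X a uv = ((0 : EuclideanSpace ℝ (Fin n)), a + B uv.1 uv.2 a)) :
    ∀ a b : EuclideanSpace ℝ (Fin m),
      ∀ u ∈ U, ∀ v : EuclideanSpace ℝ (Fin m),
        (fderivWithin ℝ (X b) (U ×ˢ (univ : Set (EuclideanSpace ℝ (Fin m)))) (u, v) (X a (u, v)) -
         fderivWithin ℝ (X a) (U ×ˢ (univ : Set (EuclideanSpace ℝ (Fin m)))) (u, v) (X b (u, v)))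
        = ((0 : EuclideanSpace ℝ (Fin n)),
            B u a b - B u b a + B u (B u v a) b - B u (B u v b) a) ∧
        (fderivWithin ℝ (X b) (U ×ˢ (univ : Set (EuclideanSpace ℝ (Fin m)))) (u, 0) (X a (u, 0)) -
         fderivWithin ℝ (X a) (U ×ˢ (univ : Set (EuclideanSpace ℝ (Fin m)))) (u, 0) (X b (u, 0)))
        = ((0 : EuclideanSpace ℝ (Fin n)), B u a b - B u b a) := by
  intro a b u hu v
  have hBu : DifferentiableAt ℝ B u :=
    (hB.contDiffAt (hU.mem_nhds hu)).differentiableAt (by simp)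
  have hD (c v w) : fderivWithin ℝ (X c) (U ×ˢ univ) (u, v) (0, w) = (0, B u w c) := by
    rw [fderivWithin_of_isOpen (hU.prod isOpen_univ) ⟨hu, mem_univ v⟩, funext (hX c)]
    exact fderiv_vertical_apply hBu c v w
  constructor
  · simp only [hX, hD, Prod.mk_sub_mk, sub_zero, map_add, add_apply]
    congr 1
    abel
  · simp [hX, hD]
end

section
/- Let U ⊆ ℝⁿ and V ⊆ ℝᵐ be open neighborhoods of 0, B : U → (ℝᵐ × ℝᵐ → ℝᵐ) a smooth family of bilinear maps, and σ : U × V → U a smooth map with σ(u,0) = u for all u ∈ U. For a smooth map ξ₀ : U → ℝᵐ define the smooth vector field X_ξ on U × V by X_ξ(u,v) = (0, ξ₀(σ(u,v)) + B(u)(v, ξ₀(σ(u,v)))). Then for any two smooth maps ξ₀, η₀ : U → ℝᵐ and every u ∈ U, the Lie bracket at (u,0) is [X_ξ, X_η](u,0) = (0, Dη₀(u)(ρ(u)(ξ₀(u))) − Dξ₀(u)(ρ(u)(η₀(u))) + B(u)(ξ₀(u), η₀(u)) − B(u)(η₀(u), ξ₀(u))), where ρ(u) := ∂σ/∂v(u,0)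 : ℝᵐ → ℝⁿ. -/
open Set

/-- The derivative at `(u, 0)`, in a vertical direction, of the vertical vector field
`(u, v) ↦ (0, f (σ (u, v)) + B u v (f (σ (u, v))))`. -/
theorem fderivWithin_vertical_field_apply
    {E F : Type*} [NormedAddCommGroup E] [NormedSpace ℝ E]
    [NormedAddCommGroup F] [NormedSpace ℝ F] {U : Set E} {V : Set F}
    (hU : IsOpen U) (hV : IsOpen V) (hV0 : (0 : F) ∈ V) {B : E → F →L[ℝ] F →L[ℝ] F}
    {σ : E × F → E} {f : E → F} {u : E} (hu : u ∈ U) (hB : DifferentiableWithinAt ℝ B U u)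
    (hσ : DifferentiableWithinAt ℝ σ (U ×ˢ V) (u, 0)) (hσ0 : σ (u, 0) = u)
    (hf : DifferentiableWithinAt ℝ f U u) (w : F) :
    fderivWithin ℝ (fun p : E × F => ((0 : E), f (σ p) + B p.1 p.2 (f (σ p)))) (U ×ˢ V) (u, 0)
        (0, w) =
      (0, fderivWithin ℝ f U u (fderivWithin ℝ σ (U ×ˢ V) (u, 0) (0, w)) + B u w (f u)) := by
  have hUV : IsOpen (U ×ˢ V) := hU.prod hV
  have hp : ((u, 0) : E × F) ∈ U ×ˢ V := ⟨hu, hV0⟩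
  have hBu : HasFDerivAt B (fderiv ℝ B u) u :=
    (hB.differentiableAt (hU.mem_nhds hu)).hasFDerivAt
  have hσu : HasFDerivAt σ (fderiv ℝ σ (u, 0)) (u, 0) :=
    (hσ.differentiableAt (hUV.mem_nhds hp)).hasFDerivAt
  have hfu : HasFDerivAt f (fderiv ℝ f u) (σ (u, 0)) := by
    rw [hσ0]
    exact (hf.differentiableAt (hU.mem_nhds hu)).hasFDerivAt
  rw [fderivWithin_of_isOpen hUV hp, fderivWithin_of_isOpen hU hu, fderivWithin_of_isOpen hUV hp]
  have hfσ : HasFDerivAt (fun p => f (σ p)) ((fderiv ℝ f u).comp (fderiv ℝ σ (u, 0))) (u, 0) :=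
    hfu.comp _ hσu
  have hBfst : HasFDerivAt (fun p : E × F => B p.1)
      ((fderiv ℝ B u).comp (ContinuousLinearMap.fst ℝ E F)) (u, 0) :=
    HasFDerivAt.comp (f := (Prod.fst : E × F → E)) (g := B) (u, (0 : F)) hBu
      (hasFDerivAt_fst (𝕜 := ℝ) (p := (u, (0 : F))))
  have h := (hasFDerivAt_const (0 : E) ((u, 0) : E × F)).prodMk
    (hfσ.add ((hBfst.clm_apply hasFDerivAt_snd).clm_apply hfσ))
  refine (congrArg (fun L => L ((0 : E), w)) h.fderiv).trans ?_
  simp [hσ0]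

/-- For a smooth family `B : U → Bil(ℝᵐ, ℝᵐ; ℝᵐ)` of bilinear maps, a smooth
`σ : U × V → U` with `σ (u,0) = u`, and smooth `ξ₀, η₀ : U → ℝᵐ`, consider the vector fields
`X_ξ (u,v) = (0, ξ₀ (σ (u,v)) + B u v (ξ₀ (σ (u,v))))` on `U × V`. Then at `(u,0)` the Lie
bracket `[X_ξ, X_η] = D X_η (X_ξ) - D X_ξ (X_η)` equals
`(0, Dη₀ (u) (ρ u (ξ₀ u)) - Dξ₀ (u) (ρ u (η₀ u)) + B u (ξ₀ u) (η₀ u) - B u (η₀ u) (ξ₀ u))`,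
where `ρ u = ∂σ/∂v (u,0)`. -/
theorem stmt_13 (n m : ℕ) (U : Set (EuclideanSpace ℝ (Fin n))) (V : Set (EuclideanSpace ℝ (Fin m)))
    (hU : IsOpen U) (hV : IsOpen V) (hV0 : (0 : EuclideanSpace ℝ (Fin m)) ∈ V)
    (B : EuclideanSpace ℝ (Fin n) →
      EuclideanSpace ℝ (Fin m) →L[ℝ] EuclideanSpace ℝ (Fin m) →L[ℝ] EuclideanSpace ℝ (Fin m))
    (hB : ContDiffOn ℝ (⊤ : ℕ∞) B U)
    (σ : EuclideanSpace ℝ (Fin n) × EuclideanSpace ℝ (Fin m) → EuclideanSpace ℝ (Fin n))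
    (hσ : ContDiffOn ℝ (⊤ : ℕ∞) σ (U ×ˢ V)) (hσU : ∀ p ∈ U ×ˢ V, σ p ∈ U)
    (hσ0 : ∀ u ∈ U, σ (u, 0) = u)
    (ξ₀ η₀ : EuclideanSpace ℝ (Fin n) → EuclideanSpace ℝ (Fin m))
    (hξ₀ : ContDiffOn ℝ (⊤ : ℕ∞) ξ₀ U) (hη₀ : ContDiffOn ℝ (⊤ : ℕ∞) η₀ U)
    (Xξ Xη : EuclideanSpace ℝ (Fin n) × EuclideanSpace ℝ (Fin m) →
      EuclideanSpace ℝ (Fin n) × EuclideanSpace ℝ (Fin m))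
    (hXξ : ∀ uv, Xξ uv = ((0 : EuclideanSpace ℝ (Fin n)),
      ξ₀ (σ uv) + B uv.1 uv.2 (ξ₀ (σ uv))))
    (hXη : ∀ uv, Xη uv = ((0 : EuclideanSpace ℝ (Fin n)),
      η₀ (σ uv) + B uv.1 uv.2 (η₀ (σ uv)))) :
    ∀ u ∈ U,
      fderivWithin ℝ Xη (U ×ˢ V) (u, 0) (Xξ (u, 0)) -
        fderivWithin ℝ Xξ (U ×ˢ V) (u, 0) (Xη (u, 0)) =
      ((0 : EuclideanSpace ℝ (Fin n)),
        fderivWithin ℝ η₀ U u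
            ((fderivWithin ℝ σ (U ×ˢ V) (u, 0)).comp
              (ContinuousLinearMap.inr ℝ (EuclideanSpace ℝ (Fin n)) (EuclideanSpace ℝ (Fin m)))
              (ξ₀ u)) -
          fderivWithin ℝ ξ₀ U u
            ((fderivWithin ℝ σ (U ×ˢ V) (u, 0)).comp
              (ContinuousLinearMap.inr ℝ (EuclideanSpace ℝ (Fin n)) (EuclideanSpace ℝ (Fin m)))
              (η₀ u)) +
          B u (ξ₀ u) (η₀ u) - B u (η₀ u) (ξ₀ u)) := by
  intro u hu
  have htop : ((⊤ : ℕ∞) : WithTop ℕ∞) ≠ 0 := by simp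
  have hX (f : EuclideanSpace ℝ (Fin n) → EuclideanSpace ℝ (Fin m))
      (hf : ContDiffOn ℝ (⊤ : ℕ∞) f U) (w : EuclideanSpace ℝ (Fin m)) :=
    fderivWithin_vertical_field_apply hU hV hV0 hu (hB.differentiableOn htop u hu)
      (hσ.differentiableOn htop (u, 0) ⟨hu, hV0⟩) (hσ0 u hu) (hf.differentiableOn htop u hu) w
  obtain rfl := funext hXξ
  obtain rfl := funext hXη
  simp only [hσ0 u hu, map_zero, zero_apply, add_zero, hX ξ₀ hξ₀, hX η₀ hη₀,
    Prod.mk_sub_mk, sub_zero, ContinuousLinearMap.comp_apply, ContinuousLinearMap.inr_apply]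
  congr 1
  abel
end
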